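/- Let G be a finite simple graph with a simplicial vertex x_1, and let W be a subset of the closed neighborhood N_G[x_1] containing x_1. Then for all r ≥ 2, reg(S/I(G)^{(r)}) ≤ max{ reg(S/I(G∖x_1)^{(r)}), reg(S/(I(G∖A)^{(r)} : x_B)) + |B| }, where the maximum runs over all partitions of W into disjoint sets A and B with x_1 ∈ B, and x_B denotes the product of the variables in B. -/

import Mathlib

open MvPolynomial

noncomputable section

namespace EdgeIdealReg

open scoped Classical

/-- The edge ideal of a simple graph, in the polynomial ring with variables the vertices. -/
def edgeIdeal (K : Type) [Field K] {V : Type} (G : SimpleGraph V) :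
    Ideal (MvPolynomial V K) :=
  Ideal.span { p | ∃ u v : V, G.Adj u v ∧ p = X u * X v }

/-- The edge ideal of the induced subgraph on a set `s` of vertices, viewed inside the
polynomial ring of the ambient graph (extra variables do not change the regularity). -/
def edgeIdealOn (K : Type) [Field K] {V : Type} (G : SimpleGraph V) (s : Set V) :
    Ideal (MvPolynomial V K) :=
  Ideal.span { p | ∃ u v : V, G.Adj u v ∧ u ∈ s ∧ v ∈ s ∧ p = X u * X v }

/-- The `r`-th symbolic power of an ideal: the intersection over all minimal primes `p` of `I`
of the contraction of `I^r` localized at `p`; concretely,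
`f ∈ I^{(r)}` iff for every minimal prime `p` of `I` there is `s ∉ p` with `s * f ∈ I ^ r`. -/
def symbolicPower {R : Type} [CommRing R] (I : Ideal R) (r : ℕ) : Ideal R where
  carrier := { f | ∀ p ∈ I.minimalPrimes, ∃ s, s ∉ p ∧ s * f ∈ I ^ r }
  zero_mem' := by
    intro p hp
    exact ⟨1, (Ideal.ne_top_iff_one p).mp hp.1.1.ne_top, by simp⟩
  add_mem' := by
    intro a b ha hb p hp
    obtain ⟨s, hs, hsa⟩ := ha p hp
    obtain ⟨t, ht, htb⟩ := hb p hp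
    refine ⟨s * t, fun h => ?_, ?_⟩
    · rcases hp.1.1.mem_or_mem h with h' | h'
      · exact hs h'
      · exact ht h'
    · have : s * t * (a + b) = t * (s * a) + s * (t * b) := by ring
      rw [this]
      exact Ideal.add_mem _ (Ideal.mul_mem_left _ _ hsa) (Ideal.mul_mem_left _ _ htb)
  smul_mem' := by
    intro c f hf p hp
    obtain ⟨s, hs, hsf⟩ := hf p hp
    refine ⟨s, hs, ?_⟩
    have : s * (c • f) = c * (s * f) := by
      simp only [smul_eq_mul]; ring
    rw [this]
    exact Ideal.mul_mem_left _ _ hsf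

/-- Symbolic power with an integer exponent, with the convention `I^{(k)} = S` for `k ≤ 0`. -/
def symbolicPowerZ {R : Type} [CommRing R] (I : Ideal R) (k : ℤ) : Ideal R :=
  if k ≤ 0 then ⊤ else symbolicPower I k.toNat

/-- A graded free resolution of `S/I` over the polynomial ring `S = K[x_v]`:
`⋯ → F_{i+1} → F_i → ⋯ → F_0 = S → S/I → 0`, where `F_i` is a graded free module with
basis elements of degrees `deg i k`, the differentials are given by matrices of homogeneous
polynomials of the appropriate degrees, the image of `F_1 → F_0 = S` is `I`, and the
complex is exact in positive homological degrees. -/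
structure GradedFreeResolution {K : Type} [Field K] {σ : Type}
    (I : Ideal (MvPolynomial σ K)) where
  rank : ℕ → ℕ
  deg : (i : ℕ) → Fin (rank i) → ℕ
  rank_zero : rank 0 = 1
  deg_zero : ∀ k, deg 0 k = 0
  mat : (i : ℕ) → Matrix (Fin (rank i)) (Fin (rank (i + 1))) (MvPolynomial σ K)
  homog : ∀ i k j, mat i k j = 0 ∨
    ∃ e, deg (i + 1) j = deg i k + e ∧ (mat i k j).IsHomogeneous e
  range_zero : ∀ f : MvPolynomial σ K,
    f ∈ I ↔ (fun _ => f) ∈ LinearMap.range (Matrix.mulVecLin (mat 0))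
  isExact : ∀ i, LinearMap.ker (Matrix.mulVecLin (mat i)) =
    LinearMap.range (Matrix.mulVecLin (mat (i + 1)))

/-- The Castelnuovo–Mumford regularity of the quotient `S/I` for a homogeneous ideal `I` of
the polynomial ring: the least `d` such that some graded free resolution of `S/I` has all its
`i`-th syzygies generated in degrees `≤ d + i` (the minimal free resolution realizes the
infimum).  By convention `reg (S/S) = ⊥ = -∞`. -/

def regQuot {K : Type} [Field K] {σ : Type} (I : Ideal (MvPolynomial σ K)) : WithBot ℤ :=
  if I = ⊤ then ⊥
  else ((sInf { d : ℤ | ∃ F : GradedFreeResolution I,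
      ∀ i (k : Fin (F.rank i)), (F.deg i k : ℤ) ≤ d + i } : ℤ) : WithBot ℤ)

/-- A set of edges of `G` that forms a matching: pairwise disjoint edges. -/
def IsMatchingSet {V : Type} (G : SimpleGraph V) (M : Finset (Sym2 V)) : Prop :=
  (M : Set (Sym2 V)) ⊆ G.edgeSet ∧
    (M : Set (Sym2 V)).Pairwise fun e f => ∀ v, v ∈ e → v ∉ f

/-- An induced matching: a matching such that no two of its edges are joined by an edge
of `G`, i.e. it is the edge set of an induced subgraph. -/
def IsInducedMatchingSet {V : Type} (G : SimpleGraph V) (M : Finset (Sym2 V)) : Prop :=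
  IsMatchingSet G M ∧
    (M : Set (Sym2 V)).Pairwise fun e f => ∀ u v, u ∈ e → v ∈ f → ¬G.Adj u v

/-- The matching number `mat(G)`. -/
def matchingNumber {V : Type} (G : SimpleGraph V) : ℕ :=
  sSup { n | ∃ M, IsMatchingSet G M ∧ M.card = n }

/-- The induced matching number `ν(G)`. -/
def inducedMatchingNumber {V : Type} (G : SimpleGraph V) : ℕ :=
  sSup { n | ∃ M, IsInducedMatchingSet G M ∧ M.card = n }

/-- `G` has an induced cycle of length `n`. -/
def HasInducedCycle {V : Type} (G : SimpleGraph V) (n : ℕ) : Prop :=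
  ∃ f : ZMod n → V, Function.Injective f ∧
    ∀ i j : ZMod n, G.Adj (f i) (f j) ↔ (j = i + 1 ∨ i = j + 1)

/-- A graph is chordal if every induced cycle has length `3`. -/
def Chordal {V : Type} (G : SimpleGraph V) : Prop :=
  ∀ n, 4 ≤ n → ¬HasInducedCycle G n

/-- A graph is weakly chordal if every induced cycle in `G` and in `Gᶜ` has length at most 4. -/
def WeaklyChordal {V : Type} (G : SimpleGraph V) : Prop :=
  (∀ n, 5 ≤ n → ¬HasInducedCycle G n) ∧ ∀ n, 5 ≤ n → ¬HasInducedCycle Gᶜ n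

/-- The co-chordal cover number `cochord(G)`: the least `n` such that `n` co-chordal
subgraphs of `G` cover all the edges of `G`. -/
def cochordNumber {V : Type} (G : SimpleGraph V) : ℕ :=
  sInf { n | ∃ H : Fin n → SimpleGraph V,
    (∀ i, H i ≤ G ∧ Chordal (H i)ᶜ) ∧ ∀ e ∈ G.edgeSet, ∃ i, e ∈ (H i).edgeSet }

/-- A graph is unicyclic if it contains exactly one cycle. -/
def Unicyclic {V : Type} (G : SimpleGraph V) : Prop :=
  ∃ (v : V) (c : G.Walk v v), c.IsCycle ∧
    ∀ (w : V) (c' : G.Walk w w), c'.IsCycle → { e | e ∈ c'.edges } = { e | e ∈ c.edges }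

/-- Data exhibiting `G` as the graph `H_T` obtained from the induced subgraph on `Hset`
by attaching, at each vertex of `T ⊆ Hset`, a union of complete graphs having that vertex as
their only common vertex: a family of cliques `C i` of `G`, each meeting `Hset` exactly in
its attachment vertex `a i ∈ T`, two distinct cliques meeting in at most the common
attachment vertex, together covering all vertices outside `Hset`, and all edges of `G`
lying either inside `Hset` or inside one of the cliques. -/
structure CliqueAttachment {V : Type} (G : SimpleGraph V) (Hset T : Set V) where
  ι : Type
  C : ι → Finset V
  a : ι → V
  a_mem_T : ∀ i, a i ∈ T
  T_sub : T ⊆ Hset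
  inter_H : ∀ i, (C i : Set V) ∩ Hset = {a i}
  a_mem_C : ∀ i, a i ∈ C i
  clique : ∀ i, G.IsClique (C i)
  pairwise_inter : ∀ i j, i ≠ j → (C i : Set V) ∩ (C j : Set V) ⊆ ({a i} : Set V)
  cover : Hset ∪ (⋃ i, (C i : Set V)) = Set.univ
  edges_sub : ∀ u v, G.Adj u v → (u ∈ Hset ∧ v ∈ Hset) ∨ ∃ i, u ∈ C i ∧ v ∈ C i

end EdgeIdealReg



namespace RegAux

open MvPolynomial

variable {K V : Type} [Field K]

lemma hc_mul {p q : MvPolynomial V K} {k : ℕ} (hq : q.IsHomogeneous k) (n : ℕ) :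
    homogeneousComponent n (p * q) =
      if k ≤ n then homogeneousComponent (n - k) p * q else 0 := by
  classical
  let _ := MvPolynomial.gradedAlgebra (σ := V) (R := K)
  have h := DirectSum.coe_decompose_mul_of_right_mem (homogeneousSubmodule V K) (a := p) (b := q)
    (i := k) n hq
  have e : ∀ (f : MvPolynomial V K) (n : ℕ),
      (DirectSum.decompose (homogeneousSubmodule V K) f n : MvPolynomial V K) =
        homogeneousComponent n f := fun f n => decomposition.decompose'_apply f n
  rw [e, e] at h
  exact h

/-- A vector in a graded free module is homogeneous of degree `e`. -/
def HV {ι : Type} (deg : ι → ℕ) (e : ℕ) (f : ι → MvPolynomial V K) : Prop :=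
  ∀ i, f i = 0 ∨ ∃ k, e = deg i + k ∧ (f i).IsHomogeneous k

/-- The degree `e` component of a vector in a graded free module. -/
def comp {ι : Type} (deg : ι → ℕ) (e : ℕ) (f : ι → MvPolynomial V K) : ι → MvPolynomial V K :=
  fun i => if deg i ≤ e then homogeneousComponent (e - deg i) (f i) else 0

lemma comp_HV {ι : Type} (deg : ι → ℕ) (e : ℕ) (f : ι → MvPolynomial V K) :
    HV deg e (comp deg e f) := by
  intro i
  by_cases h : deg i ≤ e
  · right
    refine ⟨e - deg i, by omega, ?_⟩
    simp only [comp, h, if_true]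
    exact homogeneousComponent_isHomogeneous _ _
  · left
    simp [comp, h]

lemma comp_eq_self {ι : Type} {deg : ι → ℕ} {e : ℕ} {f : ι → MvPolynomial V K}
    (h : HV deg e f) : comp deg e f = f := by
  funext i
  rcases h i with h | ⟨k, hk, h⟩
  · simp [comp, h]
  · have : deg i ≤ e := by omega
    have h2 : e - deg i = k := by omega
    simp only [comp, this, if_true, h2]
    exact homogeneousComponent_eq_self h

lemma comp_zero {ι : Type} (deg : ι → ℕ) (e : ℕ) :
    comp deg e (0 : ι → MvPolynomial V K) = 0 := by
  funext i
  simp [comp]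

lemma comp_elim {ι' ι'' : Type} (deg' : ι' → ℕ) (deg'' : ι'' → ℕ) (e : ℕ)
    (a : ι' → MvPolynomial V K) (b : ι'' → MvPolynomial V K) :
    comp (Sum.elim deg' deg'') e (Sum.elim a b) = Sum.elim (comp deg' e a) (comp deg'' e b) := by
  funext i
  rcases i with i | i <;> rfl

/-- The map of free modules with columns `c`. -/
abbrev lc {κ ι : Type} [Fintype κ] (c : κ → ι → MvPolynomial V K) :
    (κ → MvPolynomial V K) →ₗ[MvPolynomial V K] (ι → MvPolynomial V K) :=
  Fintype.linearCombination (MvPolynomial V K) c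

lemma lc_apply {κ ι : Type} [Fintype κ] (c : κ → ι → MvPolynomial V K)
    (b : κ → MvPolynomial V K) (i : ι) : lc c b i = ∑ j, b j * c j i := by
  simp [lc, Fintype.linearCombination_apply]

lemma lc_comp {κ ι : Type} [Fintype κ] {c : κ → ι → MvPolynomial V K} {deg : ι → ℕ}
    {deg' : κ → ℕ} (hc : ∀ j, HV deg (deg' j) (c j)) (e : ℕ) (b : κ → MvPolynomial V K) :
    lc c (comp deg' e b) = comp deg e (lc c b) := by
  funext i
  rw [lc_apply]
  have : comp deg e (lc c b) i =
      ∑ j, (if deg i ≤ e then homogeneousComponent (e - deg i) (b j * c j i) else 0) := by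
    unfold comp
    rw [lc_apply]
    split_ifs with h
    · rw [map_sum]
    · simp
  rw [this]
  refine Finset.sum_congr rfl fun j _ => ?_
  rcases hc j i with h | ⟨k, hk, h⟩
  · simp [h]
  · rw [hc_mul h]
    unfold comp
    by_cases h1 : deg' j ≤ e
    · have h2 : deg i ≤ e := by omega
      have h3 : k ≤ e - deg i := by omega
      have h4 : e - deg i - k = e - deg' j := by omega
      simp [h1, h2, h3, h4]
    · have h3 : deg i ≤ e → ¬ k ≤ e - deg i := by omega
      by_cases h2 : deg i ≤ e
      · simp [h1, h2, h3 h2]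
      · simp [h1, h2]

/-- Sums: columns indexed by a sum type. -/
lemma lc_elim {κ' κ'' ι : Type} [Fintype κ'] [Fintype κ''] (c' : κ' → ι → MvPolynomial V K)
    (c'' : κ'' → ι → MvPolynomial V K) (a : κ' → MvPolynomial V K) (b : κ'' → MvPolynomial V K) :
    lc (Sum.elim c' c'') (Sum.elim a b) = lc c' a + lc c'' b := by
  funext i
  simp [lc_apply]

/-- A submodule of a graded free module. -/
structure Obj (K V : Type) [Field K] where
  ι : Type
  fin : Fintype ι
  deg : ι → ℕ
  N : Submodule (MvPolynomial V K) (ι → MvPolynomial V K)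

def Graded {ι : Type} (deg : ι → ℕ)
    (N : Submodule (MvPolynomial V K) (ι → MvPolynomial V K)) : Prop :=
  ∀ f ∈ N, ∀ e, comp deg e f ∈ N

lemma graded_ker {κ ι : Type} [Fintype κ] {c : κ → ι → MvPolynomial V K} {deg : ι → ℕ}
    {deg' : κ → ℕ} (hc : ∀ j, HV deg (deg' j) (c j)) : Graded deg' (LinearMap.ker (lc c)) := by
  intro f hf e
  rw [LinearMap.mem_ker] at hf ⊢
  rw [lc_comp hc, hf, comp_zero]

/-- One step of a resolution. -/
def Step (P : ℤ → Obj K V → Prop) (d : ℤ) (O : Obj K V) : Prop :=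
  ∃ (κ : Type) (_ : Fintype κ) (deg' : κ → ℕ) (c : κ → O.ι → MvPolynomial V K),
    (∀ j, (deg' j : ℤ) ≤ d) ∧ (∀ j, HV O.deg (deg' j) (c j)) ∧
    LinearMap.range (lc c) = O.N ∧ P (d + 1) ⟨κ, inferInstance, deg', LinearMap.ker (lc c)⟩

lemma Step.mono {P Q : ℤ → Obj K V → Prop} (h : ∀ d O, P d O → Q d O) {d : ℤ} {O : Obj K V}
    (hs : Step P d O) : Step Q d O := by
  obtain ⟨κ, i, deg', c, h1, h2, h3, h4⟩ := hs
  exact ⟨κ, i, deg', c, h1, h2, h3, h _ _ h4⟩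

/-- The submodule has a free resolution with degree bounds `d, d+1, …`. -/
def Reg (d : ℤ) (O : Obj K V) : Prop :=
  ∃ P : ℤ → Obj K V → Prop, P d O ∧ ∀ d O, P d O → Step P d O

lemma Reg.step {d : ℤ} {O : Obj K V} (h : Reg d O) : Step Reg d O := by
  obtain ⟨P, h1, h2⟩ := h
  exact (h2 _ _ h1).mono fun d O h => ⟨P, h, h2⟩

lemma Reg.coind {P : ℤ → Obj K V → Prop} (h : ∀ d O, P d O → Step (fun d O => P d O ∨ Reg d O) d O)
    {d : ℤ} {O : Obj K V} (hd : P d O) : Reg d O := by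
  refine ⟨fun d O => P d O ∨ Reg d O, Or.inl hd, ?_⟩
  rintro d O (h' | h')
  · exact h _ _ h'
  · exact h'.step.mono fun d O h => Or.inr h

lemma Reg.of_step {d : ℤ} {O : Obj K V} (h : Step Reg d O) : Reg d O :=
  Reg.coind (P := Step Reg) (fun _ _ h => h.mono fun _ _ h => Or.inr h) h

lemma Reg.mono {d d' : ℤ} (hd : d ≤ d') {O : Obj K V} (h : Reg d O) : Reg d' O := by
  refine Reg.coind (P := fun d' O => ∃ d ≤ d', Reg d O) ?_ ⟨d, hd, h⟩
  rintro d' O ⟨d, hd, h⟩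
  obtain ⟨κ, i, deg', c, h1, h2, h3, h4⟩ := h.step
  exact ⟨κ, i, deg', c, fun j => (h1 j).trans hd, h2, h3, Or.inl ⟨d + 1, by omega, h4⟩⟩

lemma HV.shift {ι : Type} {deg : ι → ℕ} {e : ℕ} {f : ι → MvPolynomial V K} (h : HV deg e f) :
    HV (fun i => deg i + 1) (e + 1) f := by
  intro i
  rcases h i with h | ⟨k, hk, h⟩
  · exact Or.inl h
  · exact Or.inr ⟨k, by dsimp only; omega, h⟩

lemma Reg.shift {d : ℤ} {O : Obj K V} (h : Reg d O) :
    Reg (d + 1) ⟨O.ι, O.fin, fun i => O.deg i + 1, O.N⟩ := by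
  refine Reg.coind (P := fun d' O' => ∃ (d : ℤ) (O : Obj K V), d' = d + 1 ∧
    O' = ⟨O.ι, O.fin, fun i => O.deg i + 1, O.N⟩ ∧ Reg d O) ?_ ⟨d, O, rfl, rfl, h⟩
  rintro d' O' ⟨d, O, rfl, rfl, h⟩
  obtain ⟨κ, i, deg', c, h1, h2, h3, h4⟩ := h.step
  refine ⟨κ, i, fun j => deg' j + 1, c, fun j => ?_, fun j => (h2 j).shift, h3,
    Or.inl ⟨d + 1, _, rfl, rfl, h4⟩⟩
  have := h1 j
  push_cast
  omega

lemma Reg.bot {d : ℤ} {ι : Type} [Fintype ι] {deg : ι → ℕ} :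
    Reg d (⟨ι, inferInstance, deg, ⊥⟩ : Obj K V) := by
  refine Reg.coind (P := fun d O => O.N = ⊥) ?_ rfl
  intro d O hO
  refine ⟨Empty, inferInstance, fun _ => 0, fun j => j.elim, fun j => j.elim, fun j => j.elim,
    ?_, Or.inl ?_⟩
  · rw [hO, LinearMap.range_eq_bot]
    ext i
    exact i.elim
  · exact Subsingleton.elim _ _

/-- Horseshoe lemma. -/
lemma horseshoe {d : ℤ} {ι' ι'' : Type} [Fintype ι'] [Fintype ι''] {deg' : ι' → ℕ}
    {deg'' : ι'' → ℕ} {N : Submodule (MvPolynomial V K) (ι' ⊕ ι'' → MvPolynomial V K)}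
    {N' : Submodule (MvPolynomial V K) (ι' → MvPolynomial V K)}
    {N'' : Submodule (MvPolynomial V K) (ι'' → MvPolynomial V K)}
    (hN : Graded (Sum.elim deg' deg'') N)
    (hN' : ∀ a, a ∈ N' ↔ Sum.elim a 0 ∈ N) (hN'' : ∀ b, b ∈ N'' ↔ ∃ a, Sum.elim a b ∈ N)
    (h' : Reg d ⟨ι', inferInstance, deg', N'⟩) (h'' : Reg d ⟨ι'', inferInstance, deg'', N''⟩) :
    Reg d ⟨ι' ⊕ ι'', inferInstance, Sum.elim deg' deg'', N⟩ := by
  refine Reg.coind (P := fun d O => ∃ (ι' ι'' : Type) (f' : Fintype ι') (f'' : Fintype ι'')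
    (deg' : ι' → ℕ) (deg'' : ι'' → ℕ)
    (N : Submodule (MvPolynomial V K) (ι' ⊕ ι'' → MvPolynomial V K))
    (N' : Submodule (MvPolynomial V K) (ι' → MvPolynomial V K))
    (N'' : Submodule (MvPolynomial V K) (ι'' → MvPolynomial V K)),
    O = ⟨ι' ⊕ ι'', inferInstance, Sum.elim deg' deg'', N⟩ ∧
    Graded (Sum.elim deg' deg'') N ∧ (∀ a, a ∈ N' ↔ Sum.elim a 0 ∈ N) ∧
    (∀ b, b ∈ N'' ↔ ∃ a, Sum.elim a b ∈ N) ∧ Reg d ⟨ι', inferInstance, deg', N'⟩ ∧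
    Reg d ⟨ι'', inferInstance, deg'', N''⟩) ?_
    ⟨ι', ι'', _, _, deg', deg'', N, N', N'', rfl, hN, hN', hN'', h', h''⟩
  clear hN hN' hN'' h' h''
  rintro d O ⟨ι', ι'', f', f'', deg', deg'', N, N', N'', rfl, hN, hN', hN'', h', h''⟩
  obtain ⟨κ', i', dg', c', h1', h2', h3', h4'⟩ := h'.step
  obtain ⟨κ'', i'', dg'', c'', h1'', h2'', h3'', h4''⟩ := h''.step
  dsimp only at c' c'' h2' h3' h2'' h3''
  have key : ∀ j, ∃ a, Sum.elim a (c'' j) ∈ N ∧ HV deg' (dg'' j) a := by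
    intro j
    have hj : c'' j ∈ N'' := by
      classical
      rw [← h3'']
      exact ⟨Pi.single j 1, by simp⟩
    obtain ⟨a, ha⟩ := (hN'' _).1 hj
    refine ⟨comp deg' (dg'' j) a, ?_, comp_HV _ _ _⟩
    have := hN _ ha (dg'' j)
    rwa [comp_elim, comp_eq_self (h2'' j)] at this
  choose a ha1 ha2 using key
  let c : κ' ⊕ κ'' → (ι' ⊕ ι'') → MvPolynomial V K :=
    Sum.elim (fun j => Sum.elim (c' j) 0) (fun j => Sum.elim (a j) (c'' j))
  have hc : ∀ α β, lc c (Sum.elim α β) = Sum.elim (lc c' α + lc a β) (lc c'' β) := by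
    intro α β
    funext i
    rcases i with i | i <;> simp [c, lc_apply]
  have hcN : ∀ j, c j ∈ N := by
    rintro (j | j)
    · refine (hN' _).1 ?_
      classical
      rw [← h3']
      exact ⟨Pi.single j 1, by simp⟩
    · exact ha1 j
  have hlcN : ∀ v, lc c v ∈ N := by
    intro v
    rw [lc, Fintype.linearCombination_apply]
    exact Submodule.sum_mem _ fun j _ => N.smul_mem _ (hcN j)
  have hHV : ∀ j, HV (Sum.elim deg' deg'') (Sum.elim dg' dg'' j) (c j) := by
    rintro (j | j) (i | i)
    · exact h2' j i
    · exact Or.inl rfl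
    · exact ha2 j i
    · exact h2'' j i
  have hsub : ∀ (p p' : ι' → MvPolynomial V K) (q : ι'' → MvPolynomial V K),
      Sum.elim p q ∈ N → Sum.elim p' q ∈ N → p - p' ∈ N' := by
    intro p p' q hp hp'
    rw [hN']
    have := N.sub_mem hp hp'
    convert this using 1
    funext i
    rcases i with i | i <;> simp
  refine ⟨κ' ⊕ κ'', inferInstance, Sum.elim dg' dg'', c, ?_, hHV, ?_, Or.inl ?_⟩
  · rintro (j | j)
    · exact h1' j
    · exact h1'' j
  · apply le_antisymm
    · rintro _ ⟨v, rfl⟩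
      exact hlcN v
    · intro n hn
      obtain ⟨p, q, rfl⟩ : ∃ p q, n = Sum.elim p q := ⟨n ∘ Sum.inl, n ∘ Sum.inr, by simp⟩
      have hq : q ∈ N'' := (hN'' _).2 ⟨p, hn⟩
      rw [← h3''] at hq
      obtain ⟨β, rfl⟩ := hq
      have h5 := hlcN (Sum.elim 0 β)
      rw [hc] at h5
      have h6 := hsub _ _ _ hn h5
      rw [← h3'] at h6
      obtain ⟨α, hα⟩ := h6
      refine ⟨Sum.elim α β, ?_⟩
      rw [hc, hα]
      simp
  · refine ⟨κ', κ'', i', i'', dg', dg'', _, _, _, rfl, graded_ker hHV, ?_, ?_, h4', h4''⟩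
    · intro α
      rw [LinearMap.mem_ker, LinearMap.mem_ker, hc]
      constructor
      · intro h
        rw [h]
        funext i
        rcases i with i | i <;> simp
      · intro h
        funext i
        have := congrFun h (Sum.inl i)
        simpa using this
    · intro β
      simp only [LinearMap.mem_ker, hc]
      constructor
      · intro h
        have h5 := hlcN (Sum.elim 0 β)
        rw [hc, h] at h5
        have h6 := (hN' _).2 h5
        rw [← h3'] at h6
        obtain ⟨α, hα⟩ := h6
        refine ⟨-α, ?_⟩
        rw [h, map_neg, hα]
        funext i
        rcases i with i | i <;> simp
      · rintro ⟨α, h⟩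
        funext i
        have := congrFun h (Sum.inr i)
        simpa using this



/-- An ideal as a submodule of the free module of rank one. -/
def toU (I : Ideal (MvPolynomial V K)) :
    Submodule (MvPolynomial V K) (Unit → MvPolynomial V K) :=
  Submodule.comap (LinearMap.proj ()) I

lemma mem_toU {I : Ideal (MvPolynomial V K)} {f : Unit → MvPolynomial V K} :
    f ∈ toU I ↔ f () ∈ I := Iff.rfl

/-- `S/I` has regularity at most `d` (for proper `I` and `0 ≤ d`). -/
def RI (d : ℤ) (I : Ideal (MvPolynomial V K)) : Prop :=
  Reg (d + 1) ⟨Unit, inferInstance, fun _ => 0, toU I⟩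

lemma RI.mono {d d' : ℤ} (h : d ≤ d') {I : Ideal (MvPolynomial V K)} (hI : RI d I) : RI d' I :=
  Reg.mono (by omega) hI

lemma RI_bot {d : ℤ} : RI d (⊥ : Ideal (MvPolynomial V K)) := by
  have : toU (⊥ : Ideal (MvPolynomial V K)) = ⊥ := by
    ext f
    rw [mem_toU, Submodule.mem_bot, Submodule.mem_bot]
    exact ⟨fun h => funext fun _ => h, fun h => congrFun h ()⟩
  unfold RI
  rw [this]
  exact Reg.bot

lemma col_mem {κ ι : Type} [Fintype κ] {c : κ → ι → MvPolynomial V K}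
    {N : Submodule (MvPolynomial V K) (ι → MvPolynomial V K)} (h : LinearMap.range (lc c) = N)
    (j : κ) : c j ∈ N := by
  classical
  rw [← h]
  exact ⟨Pi.single j 1, by simp⟩

lemma lc_mem {κ ι : Type} [Fintype κ] {c : κ → ι → MvPolynomial V K}
    {N : Submodule (MvPolynomial V K) (ι → MvPolynomial V K)} (h : ∀ j, c j ∈ N)
    (v : κ → MvPolynomial V K) : lc c v ∈ N := by
  rw [lc, Fintype.linearCombination_apply]
  exact Submodule.sum_mem _ fun j _ => N.smul_mem _ (h j)

lemma elim_surj {κ' κ'' : Type} (v : κ' ⊕ κ'' → MvPolynomial V K) :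
    ∃ p q, v = Sum.elim p q := ⟨v ∘ Sum.inl, v ∘ Sum.inr, by simp⟩

lemma HV_X (v : V) : HV (fun _ : Unit => 0) 1 (fun _ => (X v : MvPolynomial V K)) :=
  fun _ => Or.inr ⟨1, rfl, isHomogeneous_X _ _⟩

lemma lc_unit {ι : Type} (w : ι → MvPolynomial V K) (s : Unit → MvPolynomial V K) :
    lc (fun _ : Unit => w) s = s () • w := by
  funext i
  simp [lc_apply]

/-- Adding a variable that is a nonzerodivisor modulo `J`. -/
lemma koszul {d : ℤ} (hd : 0 ≤ d) {J : Ideal (MvPolynomial V K)} (v : V)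
    (hv : ∀ f, f * X v ∈ J → f ∈ J) (hJ : RI d J) : RI d (J ⊔ Ideal.span {X v}) := by
  obtain ⟨κ, i, dg, c, h1, h2, h3, h4⟩ := Reg.step hJ
  dsimp only at c h2 h3
  refine Reg.of_step ?_
  have hHV : ∀ j, HV (fun _ : Unit => 0) (Sum.elim dg (fun _ : Unit => 1) j)
      (Sum.elim c (fun (_ : Unit) (_ : Unit) => (X v : MvPolynomial V K)) j) := by
    rintro (j | j)
    · exact h2 j
    · exact HV_X v
  refine ⟨κ ⊕ Unit, inferInstance, Sum.elim dg (fun _ => 1),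
    Sum.elim c (fun _ _ => X v), ?_, hHV, ?_, ?_⟩
  · rintro (j | j)
    · exact h1 j
    · simp only [Sum.elim_inr]
      push_cast
      omega
  · apply le_antisymm
    · rintro _ ⟨w, rfl⟩
      refine lc_mem ?_ w
      rintro (j | j)
      · have := col_mem h3 j
        exact Ideal.mem_sup_left this
      · exact Ideal.mem_sup_right (Ideal.mem_span_singleton_self _)
    · intro f hf
      rw [mem_toU] at hf
      obtain ⟨g, hg, s, hs, hgs⟩ := Submodule.mem_sup.1 hf
      obtain ⟨t, rfl⟩ := Ideal.mem_span_singleton'.1 hs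
      have hg' : (fun _ : Unit => g) ∈ toU J := hg
      rw [← h3] at hg'
      obtain ⟨α, hα⟩ := hg'
      refine ⟨Sum.elim α (fun _ => t), ?_⟩
      rw [lc_elim, hα, lc_unit]
      funext u
      simpa using hgs
  · have hsh : Reg (d + 1 + 1) (⟨Unit, inferInstance, fun _ => 1, toU J⟩ : Obj K V) :=
      Reg.shift hJ
    refine horseshoe (graded_ker hHV) ?_ ?_ h4 hsh
    · intro a
      rw [LinearMap.mem_ker, LinearMap.mem_ker, lc_elim, map_zero, add_zero]
    · intro s
      simp only [LinearMap.mem_ker, lc_elim, lc_unit, mem_toU]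
      constructor
      · intro hs
        have : (fun _ : Unit => - (s () * X v)) ∈ toU J := by
          rw [mem_toU]
          exact J.neg_mem (J.mul_mem_right _ hs)
        rw [← h3] at this
        obtain ⟨α, hα⟩ := this
        refine ⟨α, ?_⟩
        rw [hα]
        funext u
        simp
      · rintro ⟨α, hα⟩
        apply hv
        have h5 : lc c α ∈ toU J := h3 ▸ ⟨α, rfl⟩
        rw [mem_toU] at h5
        have h6 := congrFun hα ()
        simp only [Pi.add_apply, Pi.smul_apply, smul_eq_mul, Pi.zero_apply] at h6
        have h7 : s () * X v = - lc c α () := by linear_combination h6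
        rw [h7]
        exact J.neg_mem h5

/-- The kernel modulo a variable. -/
lemma reg_preimage {d : ℤ} {κ : Type} [Fintype κ] {dg : κ → ℕ} (v : V)
    {q : κ → Unit → MvPolynomial V K} (hq : ∀ j, HV (fun _ => 0) (dg j) (q j))
    (hx : ∃ w, lc q w = fun _ => X v) (hL : Reg d ⟨κ, inferInstance, dg, LinearMap.ker (lc q)⟩)
    (hd' : 1 ≤ d)
    {N : Submodule (MvPolynomial V K) (κ → MvPolynomial V K)}
    (hN : ∀ b, b ∈ N ↔ ∃ s, lc q b () = s * X v) :
    Reg d ⟨κ, inferInstance, dg, N⟩ := by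
  obtain ⟨w, hw, hw1⟩ : ∃ w, lc q w = (fun _ => X v) ∧ HV dg 1 w := by
    obtain ⟨w, hw⟩ := hx
    refine ⟨comp dg 1 w, ?_, comp_HV _ _ _⟩
    rw [lc_comp hq, hw, comp_eq_self (HV_X v)]
  obtain ⟨κ3, i3, dg3, c3, h1, h2, h3, h4⟩ := hL.step
  dsimp only at c3 h2 h3
  refine Reg.of_step ?_
  have hHV : ∀ j, HV dg (Sum.elim dg3 (fun _ : Unit => 1) j)
      (Sum.elim c3 (fun (_ : Unit) => w) j) := by
    rintro (j | j)
    · exact h2 j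
    · exact hw1
  have hker : ∀ α, lc q (lc c3 α) = 0 := by
    intro α
    have : lc c3 α ∈ LinearMap.ker (lc q) := h3 ▸ ⟨α, rfl⟩
    exact this
  refine ⟨κ3 ⊕ Unit, inferInstance, Sum.elim dg3 (fun _ => 1), Sum.elim c3 (fun _ => w),
    ?_, hHV, ?_, ?_⟩
  · rintro (j | j)
    · exact h1 j
    · simp only [Sum.elim_inr]
      push_cast
      omega
  · apply le_antisymm
    · rintro _ ⟨z, rfl⟩
      obtain ⟨α, s, rfl⟩ := elim_surj z
      rw [lc_elim, lc_unit, hN, map_add, hker, map_smul, hw]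
      exact ⟨s (), by simp⟩
    · intro b hb
      obtain ⟨s, hs⟩ := (hN b).1 hb
      have : b - s • w ∈ LinearMap.ker (lc q) := by
        rw [LinearMap.mem_ker, map_sub, map_smul, hw]
        funext u
        simp only [Pi.sub_apply, Pi.smul_apply, smul_eq_mul, Pi.zero_apply]
        rw [← hs]
        exact sub_self _
      rw [← h3] at this
      obtain ⟨α, hα⟩ := this
      refine ⟨Sum.elim α (fun _ => s), ?_⟩
      rw [lc_elim, lc_unit, hα]
      simp
  · refine horseshoe (N'' := ⊥) (graded_ker hHV) ?_ ?_ h4 Reg.bot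
    · intro a
      rw [LinearMap.mem_ker, LinearMap.mem_ker, lc_elim, map_zero, add_zero]
    · intro s
      simp only [LinearMap.mem_ker, lc_elim, lc_unit, Submodule.mem_bot]
      constructor
      · rintro rfl
        exact ⟨0, by simp⟩
      · rintro ⟨α, hα⟩
        have h5 := congrArg (lc q) hα
        rw [map_add, hker, map_smul, hw, map_zero] at h5
        have h6 := congrFun h5 ()
        simp only [Pi.add_apply, Pi.smul_apply, smul_eq_mul, Pi.zero_apply, zero_add,
          mul_eq_zero, X_ne_zero, or_false] at h6
        funext u
        exact h6

/-- The main regularity step. -/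
lemma main_step {d : ℤ} (hd : 0 ≤ d) {I C : Ideal (MvPolynomial V K)} (v : V)
    (hI : ∀ f ∈ I, ∀ n, homogeneousComponent n f ∈ I)
    (hC : ∀ f, f ∈ C ↔ f * X v ∈ I)
    (h' : RI (d - 1) C) (h'' : RI d (I ⊔ Ideal.span {X v})) : RI d I := by
  obtain ⟨κ', i', dg', c', h1', h2', h3', h4'⟩ := Reg.step h'
  obtain ⟨κ'', i'', dg'', q, h1'', h2'', h3'', h4''⟩ := Reg.step h''
  dsimp only at c' q h2' h3' h2'' h3''
  have hIg : Graded (fun _ => 0) (toU I) := by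
    intro f hf e
    rw [mem_toU]
    exact hI _ hf _
  have key : ∀ j, ∃ a : Unit → MvPolynomial V K, a ∈ toU I ∧ HV (fun _ => 0) (dg'' j) a ∧
      ∃ s, q j () = a () + s * X v := by
    intro j
    have hj := col_mem h3'' j
    rw [mem_toU] at hj
    obtain ⟨g, hg, s, hs, hgs⟩ := Submodule.mem_sup.1 hj
    obtain ⟨t, rfl⟩ := Ideal.mem_span_singleton'.1 hs
    refine ⟨comp (fun _ => 0) (dg'' j) (fun _ => g), hIg _ hg _, comp_HV _ _ _, ?_⟩
    have h5 := congrFun (comp_eq_self (h2'' j)) ()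
    rw [← h5]
    simp only [comp, Nat.zero_le, if_true, Nat.sub_zero, ← hgs, map_add]
    rw [hc_mul (isHomogeneous_X _ _)]
    split_ifs
    · exact ⟨_, rfl⟩
    · exact ⟨0, by simp⟩
  choose a ha1 ha2 s hs using key
  have hqa : ∀ β, lc q β () = lc a β () + (∑ j, β j * s j) * X v := by
    intro β
    rw [lc_apply, lc_apply, Finset.sum_mul, ← Finset.sum_add_distrib]
    refine Finset.sum_congr rfl fun j _ => ?_
    rw [hs]
    ring
  have hx : (X v : MvPolynomial V K) ≠ 0 := X_ne_zero _
  let xc : κ' → Unit → MvPolynomial V K := fun j u => c' j u * X v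
  have hxc : ∀ α, lc xc α = fun u => lc c' α u * X v := by
    intro α
    funext u
    rw [lc_apply, lc_apply, Finset.sum_mul]
    refine Finset.sum_congr rfl fun j _ => ?_
    simp only [xc]
    ring
  have hHV : ∀ j, HV (fun _ => 0) (Sum.elim (fun j => dg' j + 1) dg'' j) (Sum.elim xc a j) := by
    rintro (j | j)
    · intro u
      rcases h2' j u with h | ⟨k, hk, h⟩
      · left
        simp [xc, h]
      · right
        refine ⟨k + 1, ?_, h.mul (isHomogeneous_X _ _)⟩
        dsimp only at hk
        simp only [Sum.elim_inl]
        omega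
    · exact ha2 j
  have hlcC : ∀ f : MvPolynomial V K, f * X v ∈ I → ∃ α, lc c' α = fun _ => f := by
    intro f hf
    have : (fun _ : Unit => f) ∈ toU C := (hC _).2 hf
    rw [← h3'] at this
    exact this
  refine Reg.of_step ⟨κ' ⊕ κ'', inferInstance, Sum.elim (fun j => dg' j + 1) dg'',
    Sum.elim xc a, ?_, hHV, ?_, ?_⟩
  · rintro (j | j)
    · have := h1' j
      simp only [Sum.elim_inl]
      push_cast
      omega
    · exact h1'' j
  · apply le_antisymm
    · rintro _ ⟨w, rfl⟩
      refine lc_mem ?_ w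
      rintro (j | j)
      · have := col_mem h3' j
        exact (hC _).1 this
      · exact ha1 j
    · intro f hf
      have hf2 : f ∈ toU (I ⊔ Ideal.span {X v}) := Ideal.mem_sup_left (mem_toU.1 hf)
      rw [← h3''] at hf2
      obtain ⟨β, rfl⟩ := hf2
      have h5 := lc_mem ha1 β
      have h6 := (toU I).sub_mem hf h5
      rw [mem_toU] at h6
      have h7 : (lc q β - lc a β) () = (∑ j, β j * s j) * X v := by
        rw [Pi.sub_apply, hqa]
        ring
      rw [h7] at h6
      obtain ⟨α, hα⟩ := hlcC _ h6
      refine ⟨Sum.elim α β, ?_⟩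
      rw [lc_elim, hxc, hα]
      funext u
      simp only [Pi.add_apply]
      rw [hqa]
      ring
  · let N : Submodule (MvPolynomial V K) (κ'' → MvPolynomial V K) :=
      Submodule.comap (lc q) (toU (Ideal.span {X v}))
    have hN : ∀ b, b ∈ N ↔ ∃ s, lc q b () = s * X v := by
      intro b
      rw [Submodule.mem_comap, mem_toU, Ideal.mem_span_singleton']
      exact ⟨fun ⟨s, h⟩ => ⟨s, h.symm⟩, fun ⟨s, h⟩ => ⟨s, h.symm⟩⟩
    have hK' : Reg (d + 1 + 1)
        (⟨κ', inferInstance, fun j => dg' j + 1, LinearMap.ker (lc c')⟩ : Obj K V) := by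
      have := Reg.shift h4'
      have e : d - 1 + 1 + 1 + 1 = d + 1 + 1 := by ring
      rw [e] at this
      exact this
    have hK'' : Reg (d + 1 + 1) (⟨κ'', inferInstance, dg'', N⟩ : Obj K V) := by
      refine reg_preimage v h2'' ?_ h4'' (by omega) hN
      have : (fun _ : Unit => (X v : MvPolynomial V K)) ∈ toU (I ⊔ Ideal.span {X v}) :=
        Ideal.mem_sup_right (Ideal.mem_span_singleton_self _)
      rw [← h3''] at this
      exact this
    refine horseshoe (graded_ker hHV) ?_ ?_ hK' hK''
    · intro α
      rw [LinearMap.mem_ker, LinearMap.mem_ker, lc_elim, map_zero, add_zero, hxc]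
      constructor
      · intro h
        rw [h]
        funext u
        simp
      · intro h
        funext u
        have := congrFun h u
        simpa [hx] using this
    · intro β
      rw [hN]
      simp only [LinearMap.mem_ker, lc_elim, hxc]
      constructor
      · rintro ⟨t, ht⟩
        rw [hqa] at ht
        have h5 : lc a β () = (t - ∑ j, β j * s j) * X v := by linear_combination ht
        have h6 : lc a β () ∈ I := lc_mem ha1 β
        rw [h5] at h6
        obtain ⟨α, hα⟩ := hlcC _ h6
        refine ⟨-α, ?_⟩
        rw [map_neg, hα]
        funext u
        simp only [Pi.add_apply, Pi.neg_apply, Pi.zero_apply]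
        rw [h5]
        ring
      · rintro ⟨α, hα⟩
        have h5 := congrFun hα ()
        simp only [Pi.add_apply, Pi.zero_apply] at h5
        refine ⟨(∑ j, β j * s j) - lc c' α (), ?_⟩
        rw [hqa]
        linear_combination h5



open EdgeIdealReg

lemma lc_mat {m n : ℕ} (M : Matrix (Fin m) (Fin n) (MvPolynomial V K)) :
    lc (fun j k => M k j) = Matrix.mulVecLin M := by
  refine LinearMap.ext fun b => ?_
  funext i
  rw [lc_apply, Matrix.mulVecLin_apply]
  simp only [Matrix.mulVec, dotProduct]
  exact Finset.sum_congr rfl fun j _ => mul_comm _ _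

lemma RI_of_res {d : ℤ} {I : Ideal (MvPolynomial V K)} (F : GradedFreeResolution I)
    (hF : ∀ i (k : Fin (F.rank i)), (F.deg i k : ℤ) ≤ d + i) : RI d I := by
  have hH : ∀ i j, HV (F.deg i) (F.deg (i + 1) j) (fun k => F.mat i k j) :=
    fun i j k => F.homog i k j
  have hreg : ∀ i : ℕ, Reg (d + 1 + i) (⟨Fin (F.rank i), inferInstance, F.deg i,
      LinearMap.range (Matrix.mulVecLin (F.mat i))⟩ : Obj K V) := by
    intro i
    refine Reg.coind (P := fun e O => ∃ i : ℕ, e = d + 1 + i ∧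
      O = ⟨Fin (F.rank i), inferInstance, F.deg i,
      LinearMap.range (Matrix.mulVecLin (F.mat i))⟩) ?_ ⟨i, rfl, rfl⟩
    rintro e O ⟨i, rfl, rfl⟩
    refine ⟨Fin (F.rank (i + 1)), inferInstance, F.deg (i + 1), fun j k => F.mat i k j, ?_,
      hH i, ?_, Or.inl ⟨i + 1, ?_, ?_⟩⟩
    · intro j
      have := hF _ j
      push_cast at this
      omega
    · rw [lc_mat]
    · push_cast
      ring
    · rw [lc_mat, F.isExact]
  let k0 : Fin (F.rank 0) := ⟨0, by rw [F.rank_zero]; exact one_pos⟩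
  have hk : ∀ k, k = k0 := by
    intro k
    apply Fin.ext
    have := k.2
    have h := F.rank_zero
    have : (k0 : ℕ) = 0 := rfl
    omega
  have hval : ∀ b, lc (fun (j : Fin (F.rank 1)) (_ : Unit) => F.mat 0 k0 j) b =
      fun _ => Matrix.mulVecLin (F.mat 0) b k0 := by
    intro b
    rw [← lc_mat]
    funext u
    rw [lc_apply, lc_apply]
  refine Reg.of_step ⟨Fin (F.rank 1), inferInstance, F.deg 1, fun j _ => F.mat 0 k0 j, ?_, ?_, ?_,
    ?_⟩
  · intro j
    have := hF _ j
    push_cast at this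
    omega
  · intro j u
    have := F.homog 0 k0 j
    rw [F.deg_zero] at this
    exact this
  · ext f
    rw [mem_toU, F.range_zero, LinearMap.mem_range, LinearMap.mem_range]
    refine exists_congr fun b => ?_
    rw [hval]
    constructor
    · intro h
      funext k
      rw [hk k, ← h]
    · intro h
      funext u
      rw [h]
  · have h1 := hreg 1
    rw [← F.isExact 0] at h1
    have : LinearMap.ker (lc (fun (j : Fin (F.rank 1)) (_ : Unit) => F.mat 0 k0 j)) =
        LinearMap.ker (Matrix.mulVecLin (F.mat 0)) := by
      ext b
      rw [LinearMap.mem_ker, LinearMap.mem_ker, hval]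
      constructor
      · intro h
        funext k
        rw [hk k]
        exact congrFun h ()
      · intro h
        rw [h]
        rfl
    rw [this]
    exact_mod_cast h1

lemma Reg.equiv {d : ℤ} {κ κ' : Type} [Fintype κ] [Fintype κ'] {deg : κ → ℕ}
    {N : Submodule (MvPolynomial V K) (κ → MvPolynomial V K)} (e : κ' ≃ κ)
    {N' : Submodule (MvPolynomial V K) (κ' → MvPolynomial V K)}
    (hN : ∀ b : κ → MvPolynomial V K, b ∘ e ∈ N' ↔ b ∈ N)
    (h : Reg d ⟨κ, inferInstance, deg, N⟩) : Reg d ⟨κ', inferInstance, deg ∘ e, N'⟩ := by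
  obtain ⟨κ2, i2, dg, c, h1, h2, h3, h4⟩ := h.step
  dsimp only at c h2 h3
  have hl : ∀ b, lc (fun j => c j ∘ e) b = lc c b ∘ e := by
    intro b
    funext i
    rw [lc_apply, Function.comp, lc_apply]
    rfl
  refine Reg.of_step ⟨κ2, i2, dg, fun j => c j ∘ e, h1, fun j i => h2 j (e i), ?_, ?_⟩
  · ext f
    obtain ⟨g, rfl⟩ : ∃ g, f = g ∘ e := ⟨f ∘ e.symm, by funext i; simp⟩
    dsimp only
    rw [hN, ← h3, LinearMap.mem_range, LinearMap.mem_range]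
    refine exists_congr fun b => ?_
    rw [hl]
    exact e.surjective.injective_comp_right.eq_iff
  · have : LinearMap.ker (lc (fun j => c j ∘ e)) = LinearMap.ker (lc c) := by
      ext b
      rw [LinearMap.mem_ker, LinearMap.mem_ker, hl]
      have h0 : (0 : κ' → MvPolynomial V K) = (0 : κ → MvPolynomial V K) ∘ e := rfl
      rw [h0]
      exact e.surjective.injective_comp_right.eq_iff
    rw [this]
    exact h4

lemma Reg.stepFin {d : ℤ} {O : Obj K V} (h : Reg d O) :
    ∃ (n : ℕ) (deg' : Fin n → ℕ) (c : Fin n → O.ι → MvPolynomial V K),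
      (∀ j, (deg' j : ℤ) ≤ d) ∧ (∀ j, HV O.deg (deg' j) (c j)) ∧
      LinearMap.range (lc c) = O.N ∧
      Reg (d + 1) ⟨Fin n, inferInstance, deg', LinearMap.ker (lc c)⟩ := by
  obtain ⟨κ, i, dg, c, h1, h2, h3, h4⟩ := h.step
  let e : Fin (Fintype.card κ) ≃ κ := (Fintype.equivFin κ).symm
  have hl : ∀ b : κ → MvPolynomial V K, lc (c ∘ e) (b ∘ e) = lc c b := by
    intro b
    funext i
    rw [lc_apply, lc_apply]
    exact e.sum_comp (fun j => b j * c j i)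
  refine ⟨_, dg ∘ e, c ∘ e, fun j => h1 _, fun j => h2 _, ?_, ?_⟩
  · rw [← h3]
    apply le_antisymm
    · rintro _ ⟨b, rfl⟩
      obtain ⟨g, rfl⟩ : ∃ g, b = g ∘ e := ⟨b ∘ e.symm, by funext i; simp⟩
      exact ⟨g, (hl g).symm⟩
    · rintro _ ⟨b, rfl⟩
      exact ⟨b ∘ e, hl b⟩
  · refine Reg.equiv e ?_ h4
    intro b
    rw [LinearMap.mem_ker, LinearMap.mem_ker, hl]

/-- States in the construction of a resolution. -/
structure St (K V : Type) [Field K] where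
  n : ℕ
  deg : Fin n → ℕ
  N : Submodule (MvPolynomial V K) (Fin n → MvPolynomial V K)
  d : ℤ
  h : Reg d ⟨Fin n, inferInstance, deg, N⟩

/-- The chosen columns. -/
def St.c (s : St K V) : Fin (s.h.stepFin.choose) → Fin s.n → MvPolynomial V K :=
  s.h.stepFin.choose_spec.choose_spec.choose

/-- The next state. -/
def St.next (s : St K V) : St K V where
  n := s.h.stepFin.choose
  deg := s.h.stepFin.choose_spec.choose
  N := LinearMap.ker (lc s.c)
  d := s.d + 1
  h := s.h.stepFin.choose_spec.choose_spec.choose_spec.2.2.2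

lemma St.spec (s : St K V) : (∀ j, (s.next.deg j : ℤ) ≤ s.d) ∧
    (∀ j, HV s.deg (s.next.deg j) (s.c j)) ∧ LinearMap.range (lc s.c) = s.N :=
  let h := s.h.stepFin.choose_spec.choose_spec.choose_spec
  ⟨h.1, h.2.1, h.2.2.1⟩

/-- Iterated states. -/
def St.seq (s : St K V) : ℕ → St K V
  | 0 => s
  | i + 1 => (St.seq s i).next

lemma St.seq_d (s : St K V) (i : ℕ) : (s.seq i).d = s.d + i := by
  induction i with
  | zero => simp [St.seq]
  | succ i ih =>
    have : (s.seq (i + 1)).d = (s.seq i).d + 1 := rfl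
    rw [this, ih]
    push_cast
    ring

/-- The matrices of the resolution. -/
def St.m (s : St K V) (i : ℕ) :
    Matrix (Fin (s.seq i).n) (Fin (s.seq (i + 1)).n) (MvPolynomial V K) :=
  fun k j => (s.seq i).c j k

lemma St.m_ker (s : St K V) (i : ℕ) :
    LinearMap.ker (Matrix.mulVecLin (s.m i)) = (s.seq (i + 1)).N :=
  (congrArg LinearMap.ker (lc_mat (s.m i))).symm

lemma St.m_range (s : St K V) (i : ℕ) :
    LinearMap.range (Matrix.mulVecLin (s.m i)) = (s.seq i).N :=
  (congrArg LinearMap.range (lc_mat (s.m i))).symm.trans (s.seq i).spec.2.2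

lemma res_of_RI {d : ℤ} (hd : 0 ≤ d) {I : Ideal (MvPolynomial V K)} (h : RI d I) :
    ∃ F : GradedFreeResolution I, ∀ i (k : Fin (F.rank i)), (F.deg i k : ℤ) ≤ d + i := by
  let e : Fin 1 ≃ Unit := Equiv.ofUnique _ _
  let N : Submodule (MvPolynomial V K) (Fin 1 → MvPolynomial V K) :=
    Submodule.comap (LinearMap.proj 0) I
  have h0 : Reg (d + 1) (⟨Fin 1, inferInstance, fun _ => 0, N⟩ : Obj K V) := by
    refine Reg.equiv e ?_ h
    intro b
    exact Iff.rfl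
  let s : St K V := ⟨1, fun _ => 0, N, d + 1, h0⟩
  refine ⟨⟨fun i => (s.seq i).n, fun i => (s.seq i).deg, rfl, fun _ => rfl,
    s.m, ?_, ?_, ?_⟩, ?_⟩
  · intro i k j
    exact (s.seq i).spec.2.1 j k
  · intro f
    rw [s.m_range]
    exact Iff.rfl
  · intro i
    rw [s.m_ker, s.m_range]
  · intro i k
    dsimp only at k ⊢
    rcases i with _ | i
    · have : ((s.seq 0).deg k : ℤ) = 0 := rfl
      rw [this]
      push_cast
      omega
    · have h1 := (s.seq i).spec.1 k
      rw [s.seq_d] at h1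
      have h2 : s.d = d + 1 := rfl
      rw [h2] at h1
      push_cast
      refine h1.trans ?_
      omega



/-- Monomial ideals. -/
def Mono (I : Ideal (MvPolynomial V K)) : Prop :=
  ∀ f ∈ I, ∀ m ∈ f.support, monomial m (1 : K) ∈ I

lemma mem_of_monomials {I : Ideal (MvPolynomial V K)} {f : MvPolynomial V K}
    (h : ∀ m ∈ f.support, monomial m (1 : K) ∈ I) : f ∈ I := by
  rw [f.as_sum]
  refine I.sum_mem fun m hm => ?_
  have : monomial m (coeff m f) = C (coeff m f) * monomial m (1 : K) := by
    rw [C_mul_monomial, mul_one]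
  rw [this]
  exact I.mul_mem_left _ (h m hm)

lemma Mono.mem_iff {I : Ideal (MvPolynomial V K)} (hI : Mono I) {f : MvPolynomial V K} :
    f ∈ I ↔ ∀ m ∈ f.support, monomial m (1 : K) ∈ I :=
  ⟨fun h => hI f h, mem_of_monomials⟩

lemma Mono.ext {I J : Ideal (MvPolynomial V K)} (hI : Mono I) (hJ : Mono J)
    (h : ∀ m, monomial m (1 : K) ∈ I ↔ monomial m (1 : K) ∈ J) : I = J := by
  ext f
  rw [hI.mem_iff, hJ.mem_iff]
  simp only [h]

lemma Mono.hom {I : Ideal (MvPolynomial V K)} (hI : Mono I) :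
    ∀ f ∈ I, ∀ n, homogeneousComponent n f ∈ I := by
  intro f hf n
  refine mem_of_monomials fun m hm => hI f hf m ?_
  rw [mem_support_iff, coeff_homogeneousComponent] at hm
  rw [mem_support_iff]
  intro h
  simp [h] at hm

lemma Mono.sup {I J : Ideal (MvPolynomial V K)} (hI : Mono I) (hJ : Mono J) : Mono (I ⊔ J) := by
  classical
  intro f hf m hm
  obtain ⟨g, hg, h, hh, rfl⟩ := Submodule.mem_sup.1 hf
  rcases Finset.mem_union.1 (support_add hm) with h1 | h1
  · exact Ideal.mem_sup_left (hI _ hg _ h1)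
  · exact Ideal.mem_sup_right (hJ _ hh _ h1)

lemma Mono.mem_sup {I J : Ideal (MvPolynomial V K)} (hI : Mono I) (hJ : Mono J) {m : V →₀ ℕ} :
    monomial m (1 : K) ∈ I ⊔ J ↔ monomial m (1 : K) ∈ I ∨ monomial m (1 : K) ∈ J := by
  classical
  constructor
  · intro hf
    obtain ⟨g, hg, h, hh, hgh⟩ := Submodule.mem_sup.1 hf
    have hm : m ∈ (g + h).support := by
      rw [hgh, mem_support_iff, coeff_monomial]
      simp
    rcases Finset.mem_union.1 (support_add hm) with h1 | h1
    · exact Or.inl (hI _ hg _ h1)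
    · exact Or.inr (hJ _ hh _ h1)
  · rintro (h | h)
    · exact Ideal.mem_sup_left h
    · exact Ideal.mem_sup_right h

/-- The ideal generated by a set of variables. -/
abbrev sX (K : Type) [Field K] {V : Type} (A : Set V) : Ideal (MvPolynomial V K) :=
  Ideal.span (X '' A)

lemma mem_sX {A : Set V} {m : V →₀ ℕ} : monomial m (1 : K) ∈ sX K A ↔ ∃ a ∈ A, m a ≠ 0 := by
  classical
  rw [mem_ideal_span_X_image, support_monomial]
  simp

lemma Mono_sX (A : Set V) : Mono (sX K A) := by
  intro f hf m hm
  rw [mem_ideal_span_X_image] at hf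
  exact mem_sX.2 (hf m hm)

lemma sX_singleton (v : V) : sX K {v} = Ideal.span {X v} := by
  rw [sX, Set.image_singleton]

lemma Mono_bot : Mono (⊥ : Ideal (MvPolynomial V K)) := by
  intro f hf m hm
  rw [Submodule.mem_bot] at hf
  simp [hf] at hm

/-- Colon by a monomial. -/
abbrev colonM (I : Ideal (MvPolynomial V K)) (n : V →₀ ℕ) : Ideal (MvPolynomial V K) :=
  Submodule.colon I (Ideal.span {monomial n (1 : K)})

lemma mem_colonM {I : Ideal (MvPolynomial V K)} {n : V →₀ ℕ} {f : MvPolynomial V K} :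
    f ∈ colonM I n ↔ f * monomial n 1 ∈ I := Ideal.mem_colon_span_singleton

lemma monomial_mem_colonM {I : Ideal (MvPolynomial V K)} {n m : V →₀ ℕ} :
    monomial m (1 : K) ∈ colonM I n ↔ monomial (m + n) (1 : K) ∈ I := by
  rw [mem_colonM, monomial_mul, mul_one]

lemma add_mem_support {f : MvPolynomial V K} {m : V →₀ ℕ} (n : V →₀ ℕ) (hm : m ∈ f.support) :
    m + n ∈ (f * monomial n (1 : K)).support := by
  rw [mem_support_iff, coeff_mul_monomial, mul_one]
  exact mem_support_iff.1 hm

lemma Mono.colonM {I : Ideal (MvPolynomial V K)} (hI : Mono I) (n : V →₀ ℕ) :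
    Mono (colonM I n) := by
  intro f hf m hm
  rw [monomial_mem_colonM]
  exact hI _ (mem_colonM.1 hf) _ (add_mem_support n hm)

lemma monomial_mem_mono {I : Ideal (MvPolynomial V K)} {m n : V →₀ ℕ} (h : m ≤ n)
    (hm : monomial m (1 : K) ∈ I) : monomial n (1 : K) ∈ I := by
  have : monomial n (1 : K) = monomial (n - m) 1 * monomial m 1 := by
    rw [monomial_mul, mul_one, tsub_add_cancel_of_le h]
  rw [this]
  exact I.mul_mem_left _ hm

lemma eq_top_iff_monomial {I : Ideal (MvPolynomial V K)} :
    I = ⊤ ↔ monomial 0 (1 : K) ∈ I := Ideal.eq_top_iff_one I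

/-- `reg (S/I) ≤ d`, with the convention `reg 0 = -∞`. -/
def T (d : ℤ) (I : Ideal (MvPolynomial V K)) : Prop := I = ⊤ ∨ (0 ≤ d ∧ RI d I)

lemma T.mono {d d' : ℤ} (h : d ≤ d') {I : Ideal (MvPolynomial V K)} (hI : T d I) : T d' I := by
  rcases hI with hI | ⟨h0, hI⟩
  · exact Or.inl hI
  · exact Or.inr ⟨by omega, hI.mono h⟩

lemma T_step {d : ℤ} {I : Ideal (MvPolynomial V K)} (hI : Mono I) (v : V)
    (h1 : T (d - 1) (colonM I (Finsupp.single v 1))) (h2 : T d (I ⊔ sX K {v})) : T d I := by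
  rcases h2 with h2 | ⟨hd, h2⟩
  · left
    rw [eq_top_iff_monomial, hI.mem_sup (Mono_sX _), mem_sX] at h2
    rw [eq_top_iff_monomial]
    simpa using h2
  · right
    refine ⟨hd, ?_⟩
    rw [sX_singleton] at h2
    rcases h1 with h1 | ⟨_, h1⟩
    · rw [eq_top_iff_monomial, monomial_mem_colonM, zero_add] at h1
      have : Ideal.span {X v} ≤ I := by
        rw [Ideal.span_le, Set.singleton_subset_iff]
        exact h1
      rwa [sup_eq_left.2 this] at h2
    · exact main_step hd v hI.hom (fun f => mem_colonM) h1 h2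

/-- Indicator exponent vector. -/
def ind (B : Finset V) : V →₀ ℕ := ∑ v ∈ B, Finsupp.single v 1

lemma ind_apply [DecidableEq V] (B : Finset V) (v : V) : ind B v = if v ∈ B then 1 else 0 := by
  simp [ind, Finsupp.finsetSum_apply, Finsupp.single_apply]

lemma prod_X (B : Finset V) : ∏ v ∈ B, (X v : MvPolynomial V K) = monomial (ind B) 1 := by
  classical
  rw [ind, monomial_sum_one]
  rfl

lemma T_iter [DecidableEq V] (U : Finset V) : ∀ (I : Ideal (MvPolynomial V K)) (d : ℤ), Mono I →
    (∀ A B : Finset V, A ∪ B = U → A ∩ B = ∅ →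
      T (d - B.card) (colonM I (ind B) ⊔ sX K (A : Set V))) → T d I := by
  induction U using Finset.induction_on with
  | empty =>
    intro I d hI h
    have h1 := h ∅ ∅ rfl rfl
    have : colonM I (ind ∅) ⊔ sX K ((∅ : Finset V) : Set V) = I := by
      refine ((hI.colonM _).sup (Mono_sX _)).ext hI fun m => ?_
      rw [(hI.colonM _).mem_sup (Mono_sX _), mem_sX, monomial_mem_colonM]
      simp [ind]
    rw [this] at h1
    simpa using h1
  | insert u U hu ih =>
    intro I d hI h
    refine T_step hI u ?_ ?_
    · refine ih _ _ (hI.colonM _) fun A B hAB hd => ?_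
      have huA : u ∉ A := fun h => hu (hAB ▸ Finset.mem_union_left _ h)
      have huB : u ∉ B := fun h => hu (hAB ▸ Finset.mem_union_right _ h)
      have h1 := h A (insert u B) (by rw [Finset.union_insert, hAB])
        (by rw [Finset.inter_insert_of_notMem huA, hd])
      have e1 : d - ((insert u B).card : ℤ) = d - 1 - B.card := by
        rw [Finset.card_insert_of_notMem huB]
        push_cast
        ring
      have e2 : colonM (colonM I (Finsupp.single u 1)) (ind B) = colonM I (ind (insert u B)) := by
        refine ((hI.colonM _).colonM _).ext (hI.colonM _) fun m => ?_
        rw [monomial_mem_colonM, monomial_mem_colonM, monomial_mem_colonM, ind, ind,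
          Finset.sum_insert huB, add_assoc, add_comm (Finsupp.single u 1)]
      rw [e2, ← e1]
      exact h1
    · refine ih _ _ (hI.sup (Mono_sX _)) fun A B hAB hd => ?_
      have huB : u ∉ B := fun h => hu (hAB ▸ Finset.mem_union_right _ h)
      have h1 := h (insert u A) B (by rw [Finset.insert_union, hAB])
        (by rw [Finset.insert_inter_of_notMem huB, hd])
      have e2 : colonM (I ⊔ sX K {u}) (ind B) ⊔ sX K (A : Set V) =
          colonM I (ind B) ⊔ sX K ((insert u A : Finset V) : Set V) := by
        refine (((hI.sup (Mono_sX _)).colonM _).sup (Mono_sX _)).ext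
          ((hI.colonM _).sup (Mono_sX _)) fun m => ?_
        rw [((hI.sup (Mono_sX _)).colonM _).mem_sup (Mono_sX _),
          (hI.colonM _).mem_sup (Mono_sX _), monomial_mem_colonM, monomial_mem_colonM,
          hI.mem_sup (Mono_sX _), mem_sX, mem_sX, mem_sX]
        simp [ind_apply, huB, or_assoc]
      rw [e2]
      exact h1

lemma T_koszul [DecidableEq V] {d : ℤ} {J : Ideal (MvPolynomial V K)} (hJ : Mono J) (h : T d J)
    (A : Finset V) (hA : ∀ v ∈ A, ∀ m, monomial (m + Finsupp.single v 1) (1 : K) ∈ J →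
      monomial m (1 : K) ∈ J) : T d (J ⊔ sX K (A : Set V)) := by
  induction A using Finset.induction_on with
  | empty =>
    have e : sX K ((∅ : Finset V) : Set V) = ⊥ := by simp [sX]
    rw [e, sup_bot_eq]
    exact h
  | insert a A ha ih =>
    have h1 := ih fun v hv => hA v (Finset.mem_insert_of_mem hv)
    have hM : Mono (J ⊔ sX K (A : Set V)) := hJ.sup (Mono_sX _)
    have e : J ⊔ sX K ((insert a A : Finset V) : Set V) =
        (J ⊔ sX K (A : Set V)) ⊔ Ideal.span {X a} := by
      rw [sup_assoc, ← sX_singleton, sX, sX, sX, ← Ideal.span_union, ← Set.image_union,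
        Finset.coe_insert, Set.insert_eq, Set.union_comm]
    rw [e]
    rcases h1 with h1 | ⟨hd, h1⟩
    · left
      rw [h1, top_sup_eq]
    · refine Or.inr ⟨hd, koszul hd a ?_ h1⟩
      intro f hf
      refine mem_of_monomials fun m hm => ?_
      have h2 := hM _ hf _ (add_mem_support (Finsupp.single a 1) hm)
      rw [hJ.mem_sup (Mono_sX _), mem_sX] at h2 ⊢
      rcases h2 with h2 | ⟨b, hb, h2⟩
      · exact Or.inl (hA a (Finset.mem_insert_self _ _) m h2)
      · refine Or.inr ⟨b, hb, ?_⟩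
        have : a ≠ b := by
          rintro rfl
          exact ha hb
        simpa [Finsupp.single_apply, this] using h2

lemma T_exists [Fintype V] : ∀ J : Ideal (MvPolynomial V K), Mono J → ∃ d, T d J := by
  classical
  intro J
  induction J using WellFoundedGT.induction with
  | ind J ih =>
    intro hJ
    by_cases htop : J = ⊤
    · exact ⟨0, Or.inl htop⟩
    by_cases hz : ∃ v, monomial (Finsupp.single v 1) (1 : K) ∉ J ∧
        ∃ m, monomial (m + Finsupp.single v 1) (1 : K) ∈ J ∧ monomial m (1 : K) ∉ J
    · obtain ⟨v, hv, m, hm1, hm2⟩ := hz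
      have l1 : J < colonM J (Finsupp.single v 1) := by
        refine lt_of_le_of_ne Ideal.le_colon ?_
        intro h
        rw [h, monomial_mem_colonM] at hm2
        exact hm2 hm1
      have l2 : J < J ⊔ sX K {v} := by
        refine lt_of_le_of_ne le_sup_left ?_
        intro h
        apply hv
        rw [h, hJ.mem_sup (Mono_sX _), mem_sX]
        right
        exact ⟨v, rfl, by simp⟩
      obtain ⟨d1, h1⟩ := ih _ l1 (hJ.colonM _)
      obtain ⟨d2, h2⟩ := ih _ l2 (hJ.sup (Mono_sX _))
      refine ⟨max (d1 + 1) d2, T_step hJ v (h1.mono ?_) (h2.mono (le_max_right _ _))⟩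
      have := le_max_left (d1 + 1) d2
      omega
    · push Not at hz
      let A : Finset V := Finset.univ.filter fun v => monomial (Finsupp.single v 1) (1 : K) ∈ J
      have hA : J = ⊥ ⊔ sX K (A : Set V) := by
        rw [bot_sup_eq]
        refine hJ.ext (Mono_sX _) fun m => ?_
        rw [mem_sX]
        constructor
        · intro hm
          by_contra hcon
          push Not at hcon
          have key : ∀ (n : ℕ) (m : V →₀ ℕ), m.degree = n → monomial m (1 : K) ∈ J →
              (∀ a ∈ (A : Set V), m a = 0) → False := by
            intro n
            induction n with
            | zero =>
              intro m hn hm _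
              rw [Finsupp.degree_eq_zero_iff] at hn
              rw [hn] at hm
              exact htop (eq_top_iff_monomial.2 hm)
            | succ n ihn =>
              intro m hn hm hA
              have : m ≠ 0 := by
                rintro rfl
                simp at hn
              obtain ⟨v, hv⟩ := Finsupp.ne_iff.1 this
              have hle : Finsupp.single v 1 ≤ m := by
                rw [Finsupp.single_le_iff]
                exact Nat.one_le_iff_ne_zero.2 hv
              obtain ⟨m', rfl⟩ := exists_add_of_le hle
              rw [add_comm] at hm
              have hvA : monomial (Finsupp.single v 1) (1 : K) ∉ J := by
                intro h
                refine hv (hA v ?_)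
                simp [A, h]
              refine ihn m' ?_ (hz v hvA m' hm) ?_
              · rw [map_add, Finsupp.degree_single] at hn
                omega
              · intro a ha
                have := hA a ha
                rw [Finsupp.add_apply] at this
                omega
          exact key _ m rfl hm hcon
        · rintro ⟨a, ha, hma⟩
          have ha' : monomial (Finsupp.single a 1) (1 : K) ∈ J := by simpa [A] using ha
          refine monomial_mem_mono ?_ ha'
          rw [Finsupp.single_le_iff]
          exact Nat.one_le_iff_ne_zero.2 hma
      refine ⟨0, ?_⟩
      rw [hA]
      refine T_koszul Mono_bot (Or.inr ⟨le_rfl, RI_bot⟩) A ?_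
      intro v _ m hm
      rw [Submodule.mem_bot, monomial_eq_zero] at hm
      exact absurd hm one_ne_zero

lemma regQuot_le [Fintype V] {J : Ideal (MvPolynomial V K)} (hJ : Mono J) (d : ℤ) :
    regQuot J ≤ (d : WithBot ℤ) ↔ T d J := by
  unfold regQuot
  by_cases htop : J = ⊤
  · simp [htop, T]
  rw [if_neg htop, WithBot.coe_le_coe]
  have hset : ∀ d : ℤ, (∃ F : GradedFreeResolution J,
      ∀ i (k : Fin (F.rank i)), (F.deg i k : ℤ) ≤ d + i) ↔ T d J := by
    intro d
    constructor
    · rintro ⟨F, hF⟩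
      refine Or.inr ⟨?_, RI_of_res F hF⟩
      have h0 := hF 0 ⟨0, by rw [F.rank_zero]; exact one_pos⟩
      rw [F.deg_zero] at h0
      simpa using h0
    · rintro (h | ⟨h0, h⟩)
      · exact absurd h htop
      · exact res_of_RI h0 h
  simp only [hset]
  have hb : BddBelow {d : ℤ | T d J} := by
    refine ⟨0, ?_⟩
    rintro d (h | h)
    · exact absurd h htop
    · exact h.1
  constructor
  · intro h
    have := Int.csInf_mem (s := {d : ℤ | T d J}) (T_exists J hJ) hb
    exact T.mono h this
  · intro h
    exact csInf_le hb h



/-- Substitution multiplying the variables in `C` by a new variable. -/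
def psi (K : Type) [Field K] {V : Type} [DecidableEq V] (C : Finset V) :
    MvPolynomial V K →ₐ[K] Polynomial (MvPolynomial V K) :=
  aeval fun v => if v ∈ C then Polynomial.X * Polynomial.C (X v) else Polynomial.C (X v)

/-- The weight of an exponent vector with respect to `C`. -/
def wt (C : Finset V) (m : V →₀ ℕ) : ℕ := ∑ v ∈ C, m v

lemma psi_monomial [DecidableEq V] [Fintype V] (C : Finset V) (m : V →₀ ℕ) (a : K) :
    psi K C (monomial m a) = Polynomial.C (monomial m a) * Polynomial.X ^ wt C m := by
  have h1 : ∀ v ∈ (Finset.univ : Finset V),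
      (if v ∈ C then Polynomial.X * Polynomial.C (X v : MvPolynomial V K)
        else Polynomial.C (X v)) ^ m v =
      Polynomial.C ((X v) ^ m v) * (if v ∈ C then Polynomial.X ^ m v else 1) := by
    intro v _
    split_ifs
    · rw [mul_pow, map_pow, mul_comm]
    · rw [map_pow, mul_one]
  rw [psi, aeval_monomial, Finsupp.prod_fintype _ _ (fun _ => pow_zero _),
    Finset.prod_congr rfl h1, Finset.prod_mul_distrib, monomial_eq,
    Finsupp.prod_fintype _ _ (fun _ => pow_zero _), map_mul, map_prod, wt, ← mul_assoc]
  congr 1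
  rw [Finset.prod_ite_mem, Finset.univ_inter, Finset.prod_pow_eq_pow_sum]

lemma coeff_psi [DecidableEq V] [Fintype V] (C : Finset V) (f : MvPolynomial V K) (k : ℕ)
    (m : V →₀ ℕ) :
    coeff m ((psi K C f).coeff k) = if wt C m = k then coeff m f else 0 := by
  induction f using MvPolynomial.induction_on' with
  | monomial n a =>
    rw [psi_monomial, Polynomial.coeff_C_mul, Polynomial.coeff_X_pow, coeff_monomial]
    by_cases h : n = m
    · subst h
      by_cases h2 : k = wt C n
      · subst h2
        simp
      · have h3 : wt C n ≠ k := fun h => h2 h.symm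
        simp [h2, h3]
    · by_cases h2 : k = wt C n
      · simp [h2, h]
      · simp [h2, h]
  | add p q hp hq =>
    rw [map_add, Polynomial.coeff_add, coeff_add, hp, hq, coeff_add]
    split_ifs <;> simp

lemma X_pow_dvd_psi [DecidableEq V] [Fintype V] (C : Finset V) (f : MvPolynomial V K) (r : ℕ) :
    Polynomial.X ^ r ∣ psi K C f ↔ ∀ m ∈ f.support, r ≤ wt C m := by
  rw [Polynomial.X_pow_dvd_iff]
  constructor
  · intro h m hm
    by_contra hlt
    push Not at hlt
    have h1 := congrArg (coeff m) (h _ hlt)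
    rw [coeff_psi, if_pos rfl, coeff_zero] at h1
    exact mem_support_iff.1 hm h1
  · intro h k hk
    ext m
    rw [coeff_psi, coeff_zero]
    split_ifs with hw
    · by_contra hne
      have := h m (mem_support_iff.2 hne)
      omega
    · rfl

lemma mem_sX_iff_dvd [DecidableEq V] [Fintype V] (C : Finset V) (f : MvPolynomial V K) :
    f ∈ sX K (C : Set V) ↔ Polynomial.X ∣ psi K C f := by
  have := X_pow_dvd_psi C f 1
  rw [pow_one] at this
  rw [this, mem_ideal_span_X_image]
  refine forall₂_congr fun m _ => ?_
  rw [Nat.one_le_iff_ne_zero, wt, Ne, Finset.sum_eq_zero_iff]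
  push Not
  rfl

lemma sX_prime [DecidableEq V] [Fintype V] (C : Finset V) : (sX K (C : Set V)).IsPrime := by
  have h : sX K (C : Set V) =
      Ideal.comap (psi K C) (Ideal.span {(Polynomial.X : Polynomial (MvPolynomial V K))}) := by
    ext f
    rw [mem_sX_iff_dvd, Ideal.mem_comap, Ideal.mem_span_singleton]
  rw [h]
  have : (Ideal.span {(Polynomial.X : Polynomial (MvPolynomial V K))}).IsPrime :=
    (Ideal.span_singleton_prime Polynomial.X_ne_zero).2 Polynomial.prime_X
  exact Ideal.comap_isPrime _ _

/-- Vertex covers. -/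
def Cov (H : SimpleGraph V) (C : Finset V) : Prop := ∀ u v, H.Adj u v → u ∈ C ∨ v ∈ C

lemma X_mem_sX {A : Set V} {v : V} : (X v : MvPolynomial V K) ∈ sX K A ↔ v ∈ A := by
  classical
  have := mem_sX (K := K) (A := A) (m := Finsupp.single v 1)
  rw [X, this]
  simp [Finsupp.single_apply]

lemma sX_mono_iff {A B : Set V} : sX K A ≤ sX K B ↔ A ⊆ B := by
  constructor
  · intro h v hv
    exact X_mem_sX.1 (h (X_mem_sX.2 hv))
  · intro h
    exact Ideal.span_mono (Set.image_mono h)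

lemma edgeIdeal_le {H : SimpleGraph V} {C : Finset V} (hC : Cov H C) :
    edgeIdeal K H ≤ sX K (C : Set V) := by
  rw [edgeIdeal, Ideal.span_le]
  rintro _ ⟨u, v, huv, rfl⟩
  rcases hC u v huv with h | h
  · exact Ideal.mul_mem_right _ _ (X_mem_sX.2 h)
  · exact Ideal.mul_mem_left _ _ (X_mem_sX.2 h)

lemma minimalPrime_spec [DecidableEq V] [Fintype V] {H : SimpleGraph V}
    {p : Ideal (MvPolynomial V K)} (hp : p ∈ (edgeIdeal K H).minimalPrimes) :
    ∃ C : Finset V, p = sX K (C : Set V) ∧ Cov H C ∧ ∀ c ∈ C, ∃ y, H.Adj c y ∧ y ∉ C := by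
  classical
  let C : Finset V := Finset.univ.filter fun v => (X v : MvPolynomial V K) ∈ p
  have hmem : ∀ v, v ∈ C ↔ (X v : MvPolynomial V K) ∈ p := by
    intro v
    simp [C]
  have hCov : Cov H C := by
    intro u v huv
    rw [hmem, hmem]
    apply hp.1.1.mem_or_mem
    exact hp.1.2 (Ideal.subset_span ⟨u, v, huv, rfl⟩)
  have hle : sX K (C : Set V) ≤ p := by
    rw [sX, Ideal.span_le]
    rintro _ ⟨v, hv, rfl⟩
    exact (hmem v).1 hv
  have hpC : ∀ D : Finset V, Cov H D → D ⊆ C → p ≤ sX K (D : Set V) := by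
    intro D hD hDC
    refine hp.2 ⟨sX_prime D, edgeIdeal_le hD⟩ ?_
    exact (sX_mono_iff.2 (by exact_mod_cast hDC)).trans hle
  have heq : p = sX K (C : Set V) := le_antisymm (hpC C hCov subset_rfl) hle
  refine ⟨C, heq, hCov, ?_⟩
  intro c hc
  by_contra hcon
  push Not at hcon
  have hD : Cov H (C.erase c) := by
    intro u v huv
    by_cases hu : u = c
    · subst hu
      exact Or.inr (Finset.mem_erase.2 ⟨huv.ne', hcon v huv⟩)
    · by_cases hv : v = c
      · subst hv
        exact Or.inl (Finset.mem_erase.2 ⟨hu, hcon u huv.symm⟩)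
      · rcases hCov u v huv with h | h
        · exact Or.inl (Finset.mem_erase.2 ⟨hu, h⟩)
        · exact Or.inr (Finset.mem_erase.2 ⟨hv, h⟩)
  have h1 := hpC _ hD (Finset.erase_subset _ _) ((hmem c).1 hc)
  have h2 := X_mem_sX.1 h1
  simp at h2

lemma monomial_mem_pow [Fintype V] {C : Finset V} {r : ℕ} {m : V →₀ ℕ} (h : r ≤ wt C m) :
    monomial m (1 : K) ∈ sX K (C : Set V) ^ r := by
  have h1 : ∏ v ∈ C, (X v : MvPolynomial V K) ^ m v ∈ sX K (C : Set V) ^ wt C m := by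
    rw [wt, ← Finset.prod_pow_eq_pow_sum]
    refine Ideal.prod_mem_prod fun v hv => ?_
    exact Ideal.pow_mem_pow (X_mem_sX.2 hv) _
  have h2 : ∏ v ∈ C, (X v : MvPolynomial V K) ^ m v ∣ monomial m (1 : K) := by
    rw [monomial_eq, Finsupp.prod_fintype _ _ (fun _ => pow_zero _), map_one, one_mul]
    exact Finset.prod_dvd_prod_of_subset _ _ _ (Finset.subset_univ _)
  exact Ideal.mem_of_dvd _ h2 (Ideal.pow_le_pow_right h h1)

lemma mem_symbolic [DecidableEq V] [Fintype V] (H : SimpleGraph V) (r : ℕ)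
    (f : MvPolynomial V K) : f ∈ symbolicPower (edgeIdeal K H) r ↔
      ∀ C : Finset V, Cov H C → ∀ m ∈ f.support, r ≤ wt C m := by
  constructor
  · intro hf C hC m hm
    haveI := sX_prime (K := K) C
    obtain ⟨p, hp, hpC⟩ := Ideal.exists_minimalPrimes_le (edgeIdeal_le (K := K) hC)
    obtain ⟨D, rfl, hD, _⟩ := minimalPrime_spec hp
    obtain ⟨s, hs, hsf⟩ := hf _ hp
    have hDC : D ⊆ C := by exact_mod_cast sX_mono_iff.1 hpC
    have h1 : Polynomial.X ^ r ∣ psi K D (s * f) := by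
      have h2 : edgeIdeal K H ≤
          Ideal.comap (psi K D) (Ideal.span {(Polynomial.X : Polynomial (MvPolynomial V K))}) := by
        intro g hg
        rw [Ideal.mem_comap, Ideal.mem_span_singleton, ← mem_sX_iff_dvd]
        exact edgeIdeal_le hD hg
      have h3 := (Ideal.pow_right_mono h2 r).trans (Ideal.le_comap_pow _ r) hsf
      rw [Ideal.mem_comap, Ideal.span_singleton_pow, Ideal.mem_span_singleton] at h3
      exact h3
    rw [map_mul] at h1
    rw [mem_sX_iff_dvd] at hs
    have h4 := Polynomial.prime_X.pow_dvd_of_dvd_mul_left r hs h1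
    have h5 := (X_pow_dvd_psi D f r).1 h4 m hm
    exact h5.trans (Finset.sum_le_sum_of_subset hDC)
  · intro h p hp
    obtain ⟨C, rfl, hC, hmin⟩ := minimalPrime_spec hp
    choose! y hy1 hy2 using hmin
    have hprime := sX_prime (K := K) C
    let s : MvPolynomial V K := ∏ c ∈ C, X (y c)
    refine ⟨s ^ r, ?_, ?_⟩
    · intro hs
      have h1 := hprime.mem_of_pow_mem r hs
      obtain ⟨c, hc, h2⟩ := hprime.prod_mem_iff.1 h1
      exact hy2 c hc (X_mem_sX.1 h2)
    · have h1 : Ideal.span {s} * sX K (C : Set V) ≤ edgeIdeal K H := by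
        rw [sX, Ideal.span_mul_span', Ideal.span_le]
        rintro _ ⟨a, ha, _, ⟨c, hc, rfl⟩, rfl⟩
        rw [Set.mem_singleton_iff] at ha
        subst ha
        have hdvd : (X (y c) : MvPolynomial V K) ∣ s := Finset.dvd_prod_of_mem _ hc
        obtain ⟨t, ht⟩ := hdvd
        have : s * X c = t * (X c * X (y c)) := by
          rw [ht]
          ring
        dsimp only
        rw [this]
        exact Ideal.mul_mem_left _ _ (Ideal.subset_span ⟨c, y c, hy1 c hc, rfl⟩)
      have h2 : f ∈ sX K (C : Set V) ^ r :=
        mem_of_monomials fun m hm => monomial_mem_pow (h C hC m hm)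
      have h3 := Ideal.pow_right_mono h1 r
      apply h3
      rw [mul_pow]
      exact Ideal.mul_mem_mul (Ideal.pow_mem_pow (Ideal.mem_span_singleton_self _) _) h2

lemma monomial_mem_symbolic [DecidableEq V] [Fintype V] {H : SimpleGraph V} {r : ℕ}
    {m : V →₀ ℕ} : monomial m (1 : K) ∈ symbolicPower (edgeIdeal K H) r ↔
      ∀ C : Finset V, Cov H C → r ≤ wt C m := by
  classical
  rw [mem_symbolic, support_monomial]
  simp

lemma Mono_symbolic [DecidableEq V] [Fintype V] (H : SimpleGraph V) (r : ℕ) :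
    Mono (symbolicPower (edgeIdeal K H) r) := by
  intro f hf m hm
  rw [monomial_mem_symbolic]
  rw [mem_symbolic] at hf
  exact fun C hC => hf C hC m hm

lemma symbolic_ne_top [DecidableEq V] [Fintype V] (H : SimpleGraph V) {r : ℕ} (hr : r ≠ 0) :
    symbolicPower (edgeIdeal K H) r ≠ ⊤ := by
  rw [Ne, eq_top_iff_monomial, monomial_mem_symbolic]
  intro h
  have := h Finset.univ (fun u v _ => Or.inl (Finset.mem_univ _))
  simp [wt] at this
  exact hr this

/-- The induced subgraph on `s`, on the same vertex set. -/
def sub (G : SimpleGraph V) (s : Set V) : SimpleGraph V :=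
  SimpleGraph.fromRel fun u v => G.Adj u v ∧ u ∈ s ∧ v ∈ s

lemma sub_adj {G : SimpleGraph V} {s : Set V} {u v : V} :
    (sub G s).Adj u v ↔ G.Adj u v ∧ u ∈ s ∧ v ∈ s := by
  rw [sub, SimpleGraph.fromRel_adj]
  constructor
  · rintro ⟨_, h | h⟩
    · exact h
    · exact ⟨h.1.symm, h.2.2, h.2.1⟩
  · intro h
    exact ⟨h.1.ne, Or.inl h⟩

lemma edgeIdealOn_eq (G : SimpleGraph V) (s : Set V) :
    edgeIdealOn K G s = edgeIdeal K (sub G s) := by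
  unfold edgeIdealOn edgeIdeal
  simp only [sub_adj, and_assoc]

/-- Removing the vertices in `A`. -/
lemma T_remove [DecidableEq V] [Fintype V] {G : SimpleGraph V} {r : ℕ} {d : ℤ} (A : Finset V)
    (n : V →₀ ℕ) (hn : ∀ a ∈ A, n a = 0)
    (h : T d (colonM (symbolicPower (edgeIdealOn K G ((A : Set V)ᶜ)) r) n)) :
    T d (colonM (symbolicPower (edgeIdeal K G) r) n ⊔ sX K (A : Set V)) := by
  rw [edgeIdealOn_eq] at h
  have hM1 := (Mono_symbolic (K := K) G r).colonM n
  have hM2 := (Mono_symbolic (K := K) (sub G ((A : Set V)ᶜ)) r).colonM n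
  have h1 := T_koszul hM2 h A (by
    intro v hv m hm
    rw [monomial_mem_colonM, monomial_mem_symbolic] at hm ⊢
    intro C hC
    have hC' : Cov (sub G ((A : Set V)ᶜ)) (C.erase v) := by
      intro a b hab
      have hab' := sub_adj.1 hab
      have ha : a ≠ v := by
        rintro rfl
        exact hab'.2.1 hv
      have hb : b ≠ v := by
        rintro rfl
        exact hab'.2.2 hv
      rcases hC a b hab with h | h
      · exact Or.inl (Finset.mem_erase.2 ⟨ha, h⟩)
      · exact Or.inr (Finset.mem_erase.2 ⟨hb, h⟩)
    refine (hm _ hC').trans ?_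
    have e : wt (C.erase v) (m + Finsupp.single v 1 + n) = wt (C.erase v) (m + n) := by
      refine Finset.sum_congr rfl fun a ha => ?_
      have : v ≠ a := (Finset.ne_of_mem_erase ha).symm
      simp [Finsupp.single_apply, this]
    rw [e]
    exact Finset.sum_le_sum_of_subset (Finset.erase_subset _ _))
  convert h1 using 1
  refine (hM1.sup (Mono_sX _)).ext (hM2.sup (Mono_sX _)) fun m => ?_
  rw [hM1.mem_sup (Mono_sX _), hM2.mem_sup (Mono_sX _), mem_sX]
  by_cases hA : ∃ a ∈ (A : Set V), m a ≠ 0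
  · simp only [hA, or_true]
  · simp only [hA, or_false]
    push Not at hA
    rw [monomial_mem_colonM, monomial_mem_colonM, monomial_mem_symbolic, monomial_mem_symbolic]
    constructor
    · intro h C hC
      have hC' : Cov G (C ∪ A) := by
        intro u v huv
        by_cases hu : u ∈ A
        · exact Or.inl (Finset.mem_union_right _ hu)
        by_cases hv : v ∈ A
        · exact Or.inr (Finset.mem_union_right _ hv)
        rcases hC u v (sub_adj.2 ⟨huv, hu, hv⟩) with h | h
        · exact Or.inl (Finset.mem_union_left _ h)
        · exact Or.inr (Finset.mem_union_left _ h)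
      refine (h _ hC').trans (le_of_eq ?_)
      refine (Finset.sum_subset Finset.subset_union_left ?_).symm
      intro a ha haC
      have haA : a ∈ A := by
        rcases Finset.mem_union.1 ha with h | h
        · exact absurd h haC
        · exact h
      rw [Finsupp.add_apply, hA a haA, hn a haA, add_zero]
    · intro h C hC
      exact h C fun u v huv => hC u v (sub_adj.1 huv).1

lemma colonM_zero {I : Ideal (MvPolynomial V K)} : colonM I 0 = I := by
  ext f
  rw [mem_colonM]
  have : (monomial (0 : V →₀ ℕ) (1 : K)) = 1 := rfl
  rw [this, mul_one]

lemma colonM_colonM {I : Ideal (MvPolynomial V K)} (m n : V →₀ ℕ) :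
    colonM (colonM I m) n = colonM I (m + n) := by
  ext f
  rw [mem_colonM, mem_colonM, mem_colonM, mul_assoc, monomial_mul, mul_one, add_comm]

lemma le_sub_of_add_le {a : WithBot ℤ} {b d : ℤ} (h : a + (b : WithBot ℤ) ≤ (d : WithBot ℤ)) :
    a ≤ ((d - b : ℤ) : WithBot ℤ) := by
  induction a using WithBot.recBotCoe with
  | bot => exact bot_le
  | coe a =>
    rw [← WithBot.coe_add, WithBot.coe_le_coe] at h
    rw [WithBot.coe_le_coe]
    omega

end RegAux


open EdgeIdealReg in
/-- For a simplicial vertex `x₁` of `G` and `x₁ ∈ W ⊆ N_G[x₁]`, for all `r ≥ 2`,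
`reg(S/I(G)^{(r)})` is at most the maximum of `reg(S/I(G∖x₁)^{(r)})` and of
`reg(S/(I(G∖A)^{(r)} : x_B)) + |B|` over all partitions `W = A ⊔ B` with `x₁ ∈ B`. -/
theorem reg_symbolic_simplicial_bound {V K : Type} [Field K] [Fintype V] [DecidableEq V]
    (G : SimpleGraph V) (x₁ : V) (hsimp : G.IsClique (G.neighborSet x₁))
    (W : Finset V) (hW : (W : Set V) ⊆ insert x₁ (G.neighborSet x₁)) (hx₁ : x₁ ∈ W)
    (r : ℕ) (hr : 2 ≤ r) :
    regQuot (symbolicPower (edgeIdeal K G) r) ≤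
      max (regQuot (symbolicPower (edgeIdealOn K G ({x₁}ᶜ : Set V)) r))
        (sSup { c : WithBot ℤ | ∃ A B : Finset V, A ∪ B = W ∧ A ∩ B = ∅ ∧ x₁ ∈ B ∧
          c = regQuot (Submodule.colon (symbolicPower (edgeIdealOn K G ((A : Set V)ᶜ)) r)
                (Ideal.span {∏ v ∈ B, (X v : MvPolynomial V K)}))
              + ((B.card : ℤ) : WithBot ℤ) }) := by
  classical
  have hM := RegAux.Mono_symbolic (K := K) G r
  have hMon : ∀ s : Set V, RegAux.Mono (symbolicPower (edgeIdealOn K G s) r) := by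
    intro s
    rw [RegAux.edgeIdealOn_eq]
    exact RegAux.Mono_symbolic _ r
  have hne : regQuot (symbolicPower (edgeIdealOn K G ({x₁}ᶜ : Set V)) r) ≠ ⊥ := by
    rw [RegAux.edgeIdealOn_eq, regQuot, if_neg (RegAux.symbolic_ne_top _ (by omega))]
    exact WithBot.coe_ne_bot
  have hfin : Set.Finite { c : WithBot ℤ | ∃ A B : Finset V, A ∪ B = W ∧ A ∩ B = ∅ ∧ x₁ ∈ B ∧
          c = regQuot (Submodule.colon (symbolicPower (edgeIdealOn K G ((A : Set V)ᶜ)) r)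
                (Ideal.span {∏ v ∈ B, (X v : MvPolynomial V K)}))
              + ((B.card : ℤ) : WithBot ℤ) } := by
    refine (Set.finite_range fun p : Finset V × Finset V =>
      regQuot (Submodule.colon (symbolicPower (edgeIdealOn K G ((p.1 : Set V)ᶜ)) r)
                (Ideal.span {∏ v ∈ p.2, (X v : MvPolynomial V K)}))
              + ((p.2.card : ℤ) : WithBot ℤ)).subset ?_
    rintro c ⟨A, B, -, -, -, rfl⟩
    exact ⟨(A, B), rfl⟩
  have hle1 := le_max_left (regQuot (symbolicPower (edgeIdealOn K G ({x₁}ᶜ : Set V)) r))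
    (sSup { c : WithBot ℤ | ∃ A B : Finset V, A ∪ B = W ∧ A ∩ B = ∅ ∧ x₁ ∈ B ∧
          c = regQuot (Submodule.colon (symbolicPower (edgeIdealOn K G ((A : Set V)ᶜ)) r)
                (Ideal.span {∏ v ∈ B, (X v : MvPolynomial V K)}))
              + ((B.card : ℤ) : WithBot ℤ) })
  have hle2 := fun (c : WithBot ℤ) hc => (le_csSup hfin.bddAbove (a := c) hc).trans
    (le_max_right (regQuot (symbolicPower (edgeIdealOn K G ({x₁}ᶜ : Set V)) r)) _)
  generalize max (regQuot (symbolicPower (edgeIdealOn K G ({x₁}ᶜ : Set V)) r)) _ = ρ at hle1 hle2 ⊢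
  have hρ : ρ ≠ ⊥ := fun h => hne (le_bot_iff.1 (h ▸ hle1))
  obtain ⟨d, rfl⟩ := WithBot.ne_bot_iff_exists.1 hρ
  rw [RegAux.regQuot_le (hMon _)] at hle1
  rw [RegAux.regQuot_le hM]
  refine RegAux.T_step hM x₁ ?_ ?_
  · refine RegAux.T_iter (W.erase x₁) _ _ (hM.colonM _) fun A B hAB hd => ?_
    have hx : x₁ ∉ A ∪ B := by
      rw [hAB]
      exact Finset.notMem_erase _ _
    rw [Finset.mem_union, not_or] at hx
    have hmem := hle2 _ ⟨A, insert x₁ B, by rw [Finset.union_insert, hAB, Finset.insert_erase hx₁],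
      by rw [Finset.inter_insert_of_notMem hx.1, hd], Finset.mem_insert_self _ _, rfl⟩
    have h1 := RegAux.le_sub_of_add_le hmem
    rw [RegAux.prod_X, RegAux.regQuot_le ((hMon _).colonM _)] at h1
    have h2 := RegAux.T_remove A _ (by
      intro a ha
      rw [RegAux.ind_apply, if_neg]
      intro h
      rcases Finset.mem_insert.1 h with h | h
      · exact hx.1 (h ▸ ha)
      · have : a ∈ A ∩ B := Finset.mem_inter.2 ⟨ha, h⟩
        rw [hd] at this
        exact absurd this (Finset.notMem_empty _)) h1
    have e1 : d - ((insert x₁ B).card : ℤ) = d - 1 - B.card := by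
      rw [Finset.card_insert_of_notMem hx.2]
      push_cast
      ring
    have e2 : Finsupp.single x₁ 1 + RegAux.ind B = RegAux.ind (insert x₁ B) := by
      rw [RegAux.ind, RegAux.ind, Finset.sum_insert hx.2]
    rw [RegAux.colonM_colonM, e2, ← e1]
    exact h2
  · have h2 := RegAux.T_remove (K := K) (G := G) (r := r) (d := d) {x₁} 0 (fun _ _ => rfl) (by
      rw [RegAux.colonM_zero, Finset.coe_singleton]
      exact hle1)
    rw [RegAux.colonM_zero, Finset.coe_singleton] at h2
    exact h2
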